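/- Assume each κ_s : int P → ℝⁿ (s > 0) is a bijection, and let S ⊂ ℤⁿ be finite with at least two elements and v : S → ℝ a valuation such that A_trop(S, v) is nonempty. Then the closures of the sets κ_s^{−1}(A_trop(S, v)) ⊂ P converge in the Hausdorff metric, as s → ∞, to the closure of the set {x ∈ P : there exists c ∈ C_x(P) with ∇ψ(x) + c ∈ A_trop(S, v)} (the ∇ψ-preimage of π(A_trop(S, v))). -/

import Mathlib

open Filter Set
open scoped RealInnerProductSpace Topology BigOperators ENNReal

section

variable {E : Type*} [NormedAddCommGroup E] [InnerProductSpace ℝ E]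

/-- For positive `a` and nonnegative `b`, the derivative of `t ↦ t log t` at `a` in the direction
`b - a` is bounded above by `a * b + 1`. -/
lemma log_add_one_mul_sub_le {a b : ℝ} (ha : 0 < a) (hb : 0 ≤ b) :
    (Real.log a + 1) * (b - a) ≤ a * b + 1 := by
  have h₁ : Real.log a + 1 ≤ a := by linarith [Real.log_le_sub_one_of_pos ha]
  have h₂ : 1 - a⁻¹ ≤ Real.log a := Real.one_sub_inv_le_log_of_pos ha
  have h₃ : (1 - a⁻¹) * a ≤ Real.log a * a := mul_le_mul_of_nonneg_right h₂ ha.le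
  have h₄ : (1 - a⁻¹) * a = a - 1 := by field_simp
  have h₅ : (Real.log a + 1) * b ≤ a * b := mul_le_mul_of_nonneg_right h₁ hb
  linarith

/-- The defining affine functions of a polyhedron are positive on its interior, provided that
those vanishing somewhere on the polyhedron have nonzero normals. -/
lemma inner_sub_pos_of_mem_interior {ι : Type*} {ν : ι → E} {lam : ι → ℝ} {P : Set E}
    (hP : ∀ x ∈ P, ∀ r, 0 ≤ ⟪ν r, x⟫ - lam r)
    (hν : ∀ q ∈ P, ∀ r, ⟪ν r, q⟫ - lam r = 0 → ν r ≠ 0)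
    {x : E} (hx : x ∈ interior P) (r : ι) : 0 < ⟪ν r, x⟫ - lam r := by
  have hxP := interior_subset hx
  refine lt_of_le_of_ne (hP x hxP r) fun h0 => ?_
  have hne := hν x hxP r h0.symm
  have hcont : Tendsto (fun t : ℝ => x - t • ν r) (𝓝[>] 0) (𝓝 x) := by
    have : Continuous fun t : ℝ => x - t • ν r := by fun_prop
    simpa using (this.tendsto 0).mono_left nhdsWithin_le_nhds
  obtain ⟨t, htP, ht⟩ :=
    ((hcont.eventually (mem_interior_iff_mem_nhds.1 hx)).and self_mem_nhdsWithin).exists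
  have h1 := hP _ htP r
  rw [inner_sub_right, inner_smul_right, real_inner_self_eq_norm_sq] at h1
  have h2 : 0 < t * ‖ν r‖ ^ 2 := mul_pos ht (by positivity)
  linarith

/-- The derivative of the Guillemin potential plus a differentiable function. -/
lemma hasFDerivAt_guillemin_add {ι : Type*} [Fintype ι] {ν : ι → E} {lam : ι → ℝ} {φ : E → ℝ}
    {x : E} (hpos : ∀ r, 0 < ⟪ν r, x⟫ - lam r) (hφ : DifferentiableAt ℝ φ x) :
    HasFDerivAt (fun y =>
        (1 / 2) * ∑ r, (⟪ν r, y⟫ - lam r) * Real.log (⟪ν r, y⟫ - lam r) + φ y)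
      ((1 / 2 : ℝ) • ∑ r, (Real.log (⟪ν r, x⟫ - lam r) + 1) • innerSL ℝ (ν r) + fderiv ℝ φ x)
      x := by
  refine HasFDerivAt.add (HasFDerivAt.const_mul (HasFDerivAt.fun_sum fun r _ => ?_) _)
    hφ.hasFDerivAt
  have hl : HasFDerivAt (fun y => ⟪ν r, y⟫ - lam r) (innerSL ℝ (ν r)) x :=
    (innerSL ℝ (ν r)).hasFDerivAt.sub_const _
  exact (Real.hasDerivAt_mul_log (hpos r).ne').comp_hasFDerivAt x hl

variable [CompleteSpace E]

lemma ContDiffOn.differentiableAt_gradient {ψ : E → ℝ} {U : Set E} (hU : IsOpen U)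
    (hψ : ContDiffOn ℝ 2 ψ U) {x : E} (hx : x ∈ U) : DifferentiableAt ℝ (gradient ψ) x := by
  have h : ContDiffOn ℝ 1 (fderiv ℝ ψ) U := hψ.fderiv_of_isOpen hU (by norm_num)
  have h' : DifferentiableAt ℝ (fderiv ℝ ψ) x :=
    (h.differentiableOn (by norm_num)).differentiableAt (hU.mem_nhds hx)
  exact ((InnerProductSpace.toDual ℝ E).symm.toContinuousLinearEquiv.differentiable
    |>.differentiableAt).comp x h'

/-- A lower bound on the Hessian gives strong monotonicity of the gradient. -/
lemma mul_norm_sub_sq_le_inner_gradient_sub {ψ : E → ℝ} {U : Set E} (hU : Convex ℝ U)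
    (hdiff : ∀ x ∈ U, DifferentiableAt ℝ (gradient ψ) x) {m : ℝ}
    (hHess : ∀ x ∈ U, ∀ w : E, m * ‖w‖ ^ 2 ≤ ⟪w, fderiv ℝ (gradient ψ) x w⟫)
    {x y : E} (hx : x ∈ U) (hy : y ∈ U) :
    m * ‖x - y‖ ^ 2 ≤ ⟪gradient ψ x - gradient ψ y, x - y⟫ := by
  have hmem : ∀ t ∈ Icc (0 : ℝ) 1, y + t • (x - y) ∈ U := fun t ht =>
    hU.add_smul_sub_mem hy hx ht
  have hder : ∀ t ∈ Icc (0 : ℝ) 1,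
      HasDerivAt (fun t : ℝ => ⟪x - y, gradient ψ (y + t • (x - y))⟫)
        ⟪x - y, fderiv ℝ (gradient ψ) (y + t • (x - y)) (x - y)⟫ t := by
    intro t ht
    have hline : HasDerivAt (fun t : ℝ => y + t • (x - y)) (x - y) t := by
      simpa using ((hasDerivAt_id t).smul_const (x - y)).const_add y
    have := (hdiff _ (hmem t ht)).hasFDerivAt.comp_hasDerivAt t hline
    simpa using (hasDerivAt_const t (x - y)).inner ℝ this
  obtain ⟨t, ht, h⟩ := exists_hasDerivAt_eq_slope _ _ (zero_lt_one' ℝ)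
    (fun t ht => (hder t ht).continuousAt.continuousWithinAt)
    (fun t ht => hder t (Ioo_subset_Icc_self ht))
  have := hHess _ (hmem t (Ioo_subset_Icc_self ht)) (x - y)
  rw [h] at this
  rwa [one_smul, zero_smul, add_sub_cancel, add_zero, sub_zero, div_one, ← inner_sub_right,
    real_inner_comm] at this

/-- Over a convex compact set `P`, every vector `u` decomposes as `∇ψ y + c` with `y ∈ P` and `c`
in the normal cone of `P` at `y`. -/
lemma exists_mem_sub_gradient_mem_normalCone {ψ : E → ℝ} {P : Set E} (hP : IsCompact P)
    (hPconv : Convex ℝ P) (hne : P.Nonempty) (hψ : ∀ x ∈ P, DifferentiableAt ℝ ψ x) (u : E) :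
    ∃ y ∈ P, ∀ q ∈ P, 0 ≤ ⟪u - gradient ψ y, y - q⟫ := by
  have hcont : ContinuousOn (fun y => ψ y - ⟪u, y⟫) P := fun y hy =>
    ((hψ y hy).continuousAt.sub (by fun_prop)).continuousWithinAt
  obtain ⟨y, hyP, hy⟩ := hP.exists_isMinOn hne hcont
  refine ⟨y, hyP, fun q hq => ?_⟩
  have hd : HasFDerivAt (fun y => ψ y - ⟪u, y⟫) (fderiv ℝ ψ y - innerSL ℝ u) y :=
    (hψ y hyP).hasFDerivAt.sub (innerSL ℝ u).hasFDerivAt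
  have h := hy.localize.hasFDerivWithinAt_nonneg hd.hasFDerivWithinAt
    (sub_mem_posTangentConeAt_of_segment_subset (hPconv.segment_subset hyP hq))
  rw [← neg_sub q y, inner_neg_right, inner_sub_left, inner_gradient_left]
  simp only [sub_apply, innerSL_apply_apply] at h
  linarith

/-- The gradient of the Guillemin potential plus a smooth function, at an interior point `x`, in
the direction of any point `y` of the polytope, is bounded above uniformly in `x` and `y`. -/
lemma exists_inner_gradient_guillemin_le {ι : Type*} [Fintype ι] {ν : ι → E} {lam : ι → ℝ}
    {P : Set E} (hPcomp : IsCompact P) (hP : ∀ x ∈ P, ∀ r, 0 ≤ ⟪ν r, x⟫ - lam r)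
    (hpos : ∀ x ∈ interior P, ∀ r, 0 < ⟪ν r, x⟫ - lam r)
    {φ : E → ℝ} {V : Set E} (hV : IsOpen V) (hPV : P ⊆ V) (hφ : ContDiffOn ℝ 1 φ V) :
    ∃ K : ℝ, ∀ x ∈ interior P, ∀ y ∈ P,
      ⟪gradient (fun y =>
        (1 / 2) * ∑ r, (⟪ν r, y⟫ - lam r) * Real.log (⟪ν r, y⟫ - lam r) + φ y) x, y - x⟫ ≤ K := by
  have hcont : ContinuousOn (fun p : E × E =>
      (1 / 2) * ∑ r, ((⟪ν r, p.1⟫ - lam r) * (⟪ν r, p.2⟫ - lam r) + 1)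
        + fderiv ℝ φ p.1 (p.2 - p.1)) (P ×ˢ P) := by
    have h1 : ContinuousOn (fun p : E × E => fderiv ℝ φ p.1) (P ×ˢ P) :=
      ((hφ.continuousOn_fderiv_of_isOpen hV le_rfl).mono hPV).comp continuousOn_fst
        fun p hp => hp.1
    exact (by fun_prop : Continuous fun p : E × E =>
      (1 / 2) * ∑ r, ((⟪ν r, p.1⟫ - lam r) * (⟪ν r, p.2⟫ - lam r) + 1)).continuousOn.add
        (h1.clm_apply (by fun_prop))
  obtain ⟨K, hK⟩ := (hPcomp.prod hPcomp).bddAbove_image hcont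
  refine ⟨K, fun x hx y hy => ?_⟩
  have hxP := interior_subset hx
  refine le_trans ?_ (hK (mem_image_of_mem _ (mk_mem_prod hxP hy)))
  have hφx : DifferentiableAt ℝ φ x :=
    (hφ.differentiableOn one_ne_zero).differentiableAt (hV.mem_nhds (hPV hxP))
  rw [inner_gradient_left, (hasFDerivAt_guillemin_add (hpos x hx) hφx).fderiv]
  simp only [add_apply, smul_apply,
    sum_apply, innerSL_apply_apply, smul_eq_mul]
  gcongr with r
  have := log_add_one_mul_sub_le (hpos x hx r) (hP y hy r)
  rwa [sub_sub_sub_cancel_right, ← inner_sub_right] at this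

end

/-- Hausdorff convergence of the pulled-back tropical amoebas.
Let `P` be a compact simple polytope with nonempty interior, `κ_s = ∇ψ + (1/s)∇(g_P + φ)`
the rescaled Legendre transforms (with `g_P` the Guillemin potential, `φ` smooth near `P`,
`ψ` a `C²` function on an open convex neighborhood of `P` with `Hess ψ ≥ 2c·Id`), and
assume each `κ_s : int P → ℝⁿ` (`s > 0`) is a bijection.  Let `S ⊆ ℤⁿ` be finite with at
least two elements, `v : S → ℝ` a valuation whose tropical amoeba
`A_trop(S, v) = {u : max over S of ⟨m, u⟩ − v(m) is attained at least twice}` is nonempty.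
Then the closures of `κ_s⁻¹(A_trop(S, v)) ⊆ P` converge in the Hausdorff metric, as
`s → ∞`, to the closure of `{x ∈ P : ∃ c ∈ C_x(P), ∇ψ(x) + c ∈ A_trop(S, v)}`. -/
theorem pulled_back_tropical_amoeba_hausdorff_limit {n d : ℕ}
    (ν : Fin d → EuclideanSpace ℝ (Fin n)) (lam : Fin d → ℝ)
    (P : Set (EuclideanSpace ℝ (Fin n)))
    (hPdef : P = {x | ∀ r, 0 ≤ ⟪ν r, x⟫ - lam r})
    (hPcomp : IsCompact P) (hPint : (interior P).Nonempty)
    (hsimple : ∀ q ∈ P,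
      LinearIndependent ℝ (fun r : {r : Fin d // ⟪ν r, q⟫ - lam r = 0} => ν r.1))
    (φ : EuclideanSpace ℝ (Fin n) → ℝ)
    (V : Set (EuclideanSpace ℝ (Fin n))) (hVopen : IsOpen V) (hPV : P ⊆ V)
    (hφ : ContDiffOn ℝ (⊤ : ℕ∞) φ V)
    (U : Set (EuclideanSpace ℝ (Fin n))) (hUopen : IsOpen U) (hUconv : Convex ℝ U)
    (hPU : P ⊆ U)
    (ψ : EuclideanSpace ℝ (Fin n) → ℝ) (hψ : ContDiffOn ℝ 2 ψ U)
    (c : ℝ) (hc : 0 < c)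
    (hHess : ∀ x ∈ U, ∀ w : EuclideanSpace ℝ (Fin n),
      2 * c * ‖w‖ ^ 2 ≤ ⟪w, fderiv ℝ (gradient ψ) x w⟫)
    (κ : ℝ → EuclideanSpace ℝ (Fin n) → EuclideanSpace ℝ (Fin n))
    (hκ : ∀ s x, κ s x = gradient ψ x + (1 / s) •
      gradient (fun y =>
        (1 / 2) * ∑ r, (⟪ν r, y⟫ - lam r) * Real.log (⟪ν r, y⟫ - lam r) + φ y) x)
    (hbij : ∀ s : ℝ, 0 < s → BijOn (κ s) (interior P) univ)
    (S : Set (EuclideanSpace ℝ (Fin n))) (hSfin : S.Finite)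
    (hSlat : ∀ m ∈ S, ∀ i, ∃ z : ℤ, m i = (z : ℝ))
    (hStwo : ∃ m₁ ∈ S, ∃ m₂ ∈ S, m₁ ≠ m₂)
    (v : EuclideanSpace ℝ (Fin n) → ℝ)
    (Atrop : Set (EuclideanSpace ℝ (Fin n)))
    (hAtrop : Atrop = {u | ∃ m₁ ∈ S, ∃ m₂ ∈ S, m₁ ≠ m₂ ∧
      (∀ m ∈ S, ⟪m, u⟫ - v m ≤ ⟪m₁, u⟫ - v m₁) ∧
      ⟪m₁, u⟫ - v m₁ = ⟪m₂, u⟫ - v m₂})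
    (hAne : Atrop.Nonempty) :
    Tendsto
      (fun s : ℝ =>
        EMetric.hausdorffEdist
          (closure (interior P ∩ (κ s) ⁻¹' Atrop))
          (closure {x ∈ P | ∃ c' : EuclideanSpace ℝ (Fin n),
            (∀ q ∈ P, 0 ≤ ⟪c', x - q⟫) ∧ gradient ψ x + c' ∈ Atrop}))
      atTop (𝓝 (0 : ℝ≥0∞)) := by
  have hP : ∀ x ∈ P, ∀ r, 0 ≤ ⟪ν r, x⟫ - lam r := fun x hx => by rwa [hPdef] at hx
  have hpos : ∀ x ∈ interior P, ∀ r, 0 < ⟪ν r, x⟫ - lam r := fun x hx r =>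
    inner_sub_pos_of_mem_interior hP (fun q hq r h => (hsimple q hq).ne_zero ⟨r, h⟩) hx r
  have hPconv : Convex ℝ P := by
    rw [hPdef, ofPred_forall]
    refine convex_iInter fun r => ?_
    simpa [sub_nonneg] using
      convex_halfSpace_ge (𝕜 := ℝ) (innerSL ℝ (ν r)).toLinearMap.isLinear (lam r)
  obtain ⟨K, hK⟩ := exists_inner_gradient_guillemin_le hPcomp hP hpos hVopen hPV
    (hφ.of_le (by exact_mod_cast le_top))
  have hmono : ∀ x ∈ P, ∀ y ∈ P,
      2 * c * ‖x - y‖ ^ 2 ≤ ⟪gradient ψ x - gradient ψ y, x - y⟫ := fun x hx y hy =>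
    mul_norm_sub_sq_le_inner_gradient_sub hUconv
      (fun z hz => hψ.differentiableAt_gradient hUopen hz) hHess (hPU hx) (hPU hy)
  have hdist : ∀ s : ℝ, 0 < s → ∀ x ∈ interior P, ∀ y ∈ P,
      (∀ q ∈ P, 0 ≤ ⟪κ s x - gradient ψ y, y - q⟫) →
        edist x y ≤ ENNReal.ofReal (√(K / (2 * c) / s)) := by
    intro s hs x hx y hy hcone
    rw [edist_dist, dist_eq_norm]
    refine ENNReal.ofReal_le_ofReal (Real.le_sqrt_of_sq_le ?_)
    have h1 := hmono x (interior_subset hx) y hy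
    have h2 := hcone x (interior_subset hx)
    have h3 := mul_le_mul_of_nonneg_left (hK x hx y hy) (one_div_pos.2 hs).le
    rw [hκ, add_sub_right_comm, inner_add_left, ← neg_sub x y, inner_neg_right,
      inner_neg_right, real_inner_smul_left] at h2
    rw [← neg_sub x y, inner_neg_right] at h3
    rw [div_div, le_div_iff₀ (by positivity)]
    have h4 : 2 * c * ‖x - y‖ ^ 2 ≤ 1 / s * K := by linarith
    calc ‖x - y‖ ^ 2 * (2 * c * s) = 2 * c * ‖x - y‖ ^ 2 * s := by ring
      _ ≤ 1 / s * K * s := by gcongr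
      _ = K := by field_simp
  have hlim : Tendsto (fun s : ℝ => ENNReal.ofReal (√(K / (2 * c) / s))) atTop (𝓝 0) := by
    have := ENNReal.tendsto_ofReal
      ((tendsto_const_nhds (x := K / (2 * c))).div_atTop tendsto_id).sqrt
    simpa using this
  refine tendsto_of_tendsto_of_tendsto_of_le_of_le' tendsto_const_nhds hlim
    (Eventually.of_forall fun _ => zero_le) ?_
  filter_upwards [eventually_gt_atTop 0] with s hs
  change Metric.hausdorffEDist _ _ ≤ _
  rw [Metric.hausdorffEDist_closure]
  refine Metric.hausdorffEDist_le_of_mem_edist ?_ ?_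
  · rintro x ⟨hx, hxA⟩
    obtain ⟨y, hy, hcone⟩ := exists_mem_sub_gradient_mem_normalCone hPcomp hPconv
      (hPint.mono interior_subset) (fun z hz => (hψ.differentiableOn two_ne_zero).differentiableAt
        (hUopen.mem_nhds (hPU hz))) (κ s x)
    exact ⟨y, ⟨hy, κ s x - gradient ψ y, hcone, by simpa using hxA⟩, hdist s hs x hx y hy hcone⟩
  · rintro y ⟨hy, c', hc', hA⟩
    obtain ⟨x, hx, hxu⟩ := (hbij s hs).surjOn (mem_univ (gradient ψ y + c'))
    refine ⟨x, ⟨hx, by rwa [mem_preimage, hxu]⟩, ?_⟩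
    rw [edist_comm]
    exact hdist s hs x hx y hy (by simpa [hxu] using hc')
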